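/- arXiv:2001.08104 — 2 statements merged into one kernel-verified Lean document; each statement's English description precedes it below -/
import Mathlib

section
/- The series ∑_{n=0}^∞ ((1/2)_n (1/3)_n (2/3)_n)/((1)_n^3) · (6n+1) · (1/2)^n equals 3√3/π, where (a)_n denotes the Pochhammer symbol (rising factorial). -/
open Real

noncomputable def poch (a : ℝ) (n : ℕ) : ℝ := (ascPochhammer ℝ n).eval a

open Filter Topology Set

def PB (a : ℕ → ℝ) : Prop := ∃ C : ℝ, ∃ k : ℕ, ∀ n : ℕ, |a n| ≤ C * ((n : ℝ) + 1) ^ k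

def dd (a : ℕ → ℝ) (n : ℕ) : ℝ := ((n : ℝ) + 1) * a (n + 1)

noncomputable def ps (a : ℕ → ℝ) (x : ℝ) : ℝ := ∑' n : ℕ, a n * x ^ n

theorem PB.dd {a : ℕ → ℝ} (h : PB a) : PB (dd a) := by
  obtain ⟨C, k, h⟩ := h
  have hC : 0 ≤ C := by
    have := h 0
    simp at this
    exact (abs_nonneg _).trans this
  refine ⟨C * 2 ^ k, k + 1, fun n => ?_⟩
  have h1 := h (n + 1)
  push_cast at h1
  have h0 : (0 : ℝ) ≤ n := n.cast_nonneg
  have h2 : ((n : ℝ) + 1 + 1) ^ k ≤ (2 * ((n : ℝ) + 1)) ^ k := by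
    gcongr
    linarith
  unfold _root_.dd
  rw [abs_mul, abs_of_pos (by positivity : (0 : ℝ) < n + 1)]
  calc ((n : ℝ) + 1) * |a (n + 1)| ≤ ((n : ℝ) + 1) * (C * (2 * ((n : ℝ) + 1)) ^ k) := by
        gcongr
        exact h1.trans (by gcongr)
    _ = _ := by rw [mul_pow]; ring

theorem PB.mul_nat {a : ℕ → ℝ} (h : PB a) : PB (fun n => (n : ℝ) * a n) := by
  obtain ⟨C, k, h⟩ := h
  refine ⟨C, k + 1, fun n => ?_⟩
  have h0 : (0 : ℝ) ≤ n := n.cast_nonneg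
  rw [abs_mul, abs_of_nonneg h0]
  calc (n : ℝ) * |a n| ≤ ((n : ℝ) + 1) * (C * ((n : ℝ) + 1) ^ k) := by
        apply mul_le_mul (by linarith) (h n) (abs_nonneg _) (by positivity)
    _ = _ := by ring

theorem PB.summable {a : ℕ → ℝ} (h : PB a) {x : ℝ} (hx : |x| < 1) :
    Summable (fun n => ‖a n * x ^ n‖) := by
  obtain ⟨C, k, h⟩ := h
  set r := (|x| + 1) / 2 with hr
  have hx0 := abs_nonneg x
  have hr0 : 0 < r := by linarith
  have hr1 : r < 1 := by linarith
  have hxr : |x| ≤ r := by linarith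
  have s1 := summable_pow_mul_geometric_of_norm_lt_one k (r := r)
    (by rw [Real.norm_eq_abs, abs_of_pos hr0]; exact hr1)
  have s2 := ((summable_nat_add_iff 1).2 s1).mul_left (C / r)
  refine Summable.of_nonneg_of_le (fun n => norm_nonneg _) (fun n => ?_) s2
  rw [Real.norm_eq_abs, abs_mul, abs_pow]
  calc |a n| * |x| ^ n ≤ (C * ((n : ℝ) + 1) ^ k) * r ^ n := by
        apply mul_le_mul (h n) (by gcongr) (by positivity) ((abs_nonneg _).trans (h n))
    _ = _ := by
        push_cast
        field_simp
        ring

theorem PB.sm {a : ℕ → ℝ} (h : PB a) {x : ℝ} (hx : |x| < 1) :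
    Summable (fun n => a n * x ^ n) := (h.summable hx).of_norm

theorem ps_zero (a : ℕ → ℝ) : ps a 0 = a 0 := by
  unfold ps
  rw [tsum_eq_single 0]
  · simp
  · intro n hn
    simp [hn]

theorem PB.hasDeriv {a : ℕ → ℝ} (h : PB a) {x : ℝ} (hx : |x| < 1) :
    HasDerivAt (ps a) (ps (_root_.dd a) x) x := by
  set r := (|x| + 1) / 2 with hr
  have hx0 := abs_nonneg x
  have hr0 : 0 < r := by linarith
  have hr1 : r < 1 := by linarith
  have hxr : |x| < r := by linarith
  have hu : Summable (fun n : ℕ => |a n * ((n : ℝ) * r ^ (n - 1))|) := by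
    rw [← summable_nat_add_iff 1]
    refine (h.dd.summable (x := r) (by rw [abs_of_pos hr0]; exact hr1)).congr (fun n => ?_)
    rw [Real.norm_eq_abs]
    unfold _root_.dd
    push_cast
    congr 1
    ring
  have key := hasDerivAt_tsum_of_isPreconnected (𝕜 := ℝ) (g := fun n y => a n * y ^ n)
    (g' := fun n y => a n * ((n : ℝ) * y ^ (n - 1))) (t := Ioo (-r) r) (y₀ := 0) (y := x)
    hu isOpen_Ioo isPreconnected_Ioo
    (fun n y _ => (hasDerivAt_pow n y).const_mul (a n))
    (fun n y hy => by
      have hyr : |y| ≤ r := (abs_lt.2 hy).le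
      rw [Real.norm_eq_abs, abs_mul, abs_mul, abs_mul, abs_mul, abs_pow, abs_pow, abs_of_pos hr0]
      gcongr)
    ⟨by linarith, hr0⟩ (h.sm (by simp)) (abs_lt.1 hxr)
  have e : ∑' n : ℕ, a n * ((n : ℝ) * x ^ (n - 1)) = ps (_root_.dd a) x := by
    rw [Summable.tsum_eq_zero_add]
    · simp only [Nat.cast_zero, zero_mul, mul_zero, zero_add]
      unfold ps _root_.dd
      congr 1
      ext n
      push_cast
      ring
    · rw [← summable_nat_add_iff 1]
      refine (h.dd.sm hx).congr (fun n => ?_)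
      unfold _root_.dd
      push_cast
      ring
  rw [e] at key
  exact key

theorem x_mul_ps {a : ℕ → ℝ} (h : PB a) {x : ℝ} (hx : |x| < 1) :
    ps (fun n => (n : ℝ) * a n) x = x * ps (dd a) x := by
  unfold ps
  rw [(h.mul_nat.sm hx).tsum_eq_zero_add, ← tsum_mul_left]
  simp only [Nat.cast_zero, zero_mul, zero_add]
  congr 1
  ext n
  unfold dd
  push_cast
  ring

/-- hypergeometric ODE: if `(n+1)^2 a(n+1) = (n^2 + s n + t) a n` -/
theorem ps_ode {a : ℕ → ℝ} (h : PB a) {s t : ℝ}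
    (hrec : ∀ n : ℕ, ((n : ℝ) + 1) ^ 2 * a (n + 1) = ((n : ℝ) ^ 2 + s * n + t) * a n)
    {x : ℝ} (hx : |x| < 1) :
    x * (1 - x) * ps (dd (dd a)) x + (1 - (1 + s) * x) * ps (dd a) x = t * ps a x := by
  have hA := x_mul_ps h hx
  have hB := x_mul_ps h.mul_nat hx
  have hC := x_mul_ps h.dd hx
  have e1 : ps (fun n => (n : ℝ) * dd a n) x + ps (dd a) x =
      ps (fun n => (n : ℝ) * ((n : ℝ) * a n)) x + s * ps (fun n => (n : ℝ) * a n) x + t * ps a x := by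
    unfold ps
    rw [← (h.dd.mul_nat.sm hx).tsum_add (h.dd.sm hx), ← tsum_mul_left, ← tsum_mul_left,
      ← (h.mul_nat.mul_nat.sm hx).tsum_add ((h.mul_nat.sm hx).mul_left s),
      ← ((h.mul_nat.mul_nat.sm hx).add ((h.mul_nat.sm hx).mul_left s)).tsum_add
        ((h.sm hx).mul_left t)]
    congr 1
    ext n
    unfold dd
    linear_combination (x ^ n) * hrec n
  have e2 : ps (dd (fun n => (n : ℝ) * a n)) x = ps (fun n => (n : ℝ) * dd a n) x + ps (dd a) x := by
    unfold ps
    rw [← (h.dd.mul_nat.sm hx).tsum_add (h.dd.sm hx)]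
    congr 1
    ext n
    unfold dd
    push_cast
    ring
  rw [hB, e2, hA, hC] at e1
  linear_combination e1

/-- coefficient-based bound -/
theorem PB.of_le_one {a : ℕ → ℝ} (h0 : ∀ n, 0 ≤ a n) (h1 : ∀ n, a n ≤ 1) : PB a :=
  ⟨1, 0, fun n => by rw [abs_of_nonneg (h0 n)]; simpa using h1 n⟩

theorem ps_pos {a : ℕ → ℝ} (h : PB a) (h0 : ∀ n, 0 ≤ a n) (ha : a 0 = 1) {x : ℝ} (hx0 : 0 ≤ x)
    (hx : x < 1) : 0 < ps a x := by
  have := (h.sm (x := x) (by rw [abs_of_nonneg hx0]; exact hx)).sum_le_tsum {0}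
    (fun n _ => mul_nonneg (h0 n) (pow_nonneg hx0 n))
  simp [ha] at this
  unfold ps
  linarith

/-- uniqueness for regular singular solution -/
theorem ode_unique {u v u' v' P Q : ℝ → ℝ} {b : ℝ}
    (hu : ∀ x, 0 ≤ x → x < b → HasDerivAt u (u' x) x)
    (hv : ∀ x, 0 ≤ x → x < b → HasDerivAt v (v' x) x)
    (hU : ∀ x, 0 ≤ x → x < b → HasDerivAt (fun y => P y * u' y) (Q x * u x) x)
    (hV : ∀ x, 0 ≤ x → x < b → HasDerivAt (fun y => P y * v' y) (Q x * v x) x)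
    (hP0 : P 0 = 0) (hP : ∀ x, 0 < x → x < b → P x ≠ 0)
    (hvpos : ∀ x, 0 ≤ x → x < b → v x ≠ 0) (huv : u 0 = v 0) :
    ∀ x, 0 ≤ x → x < b → u x = v x := by
  have hW : ∀ x, 0 ≤ x → x < b → HasDerivAt (fun y => P y * u' y * v y - u y * (P y * v' y)) 0 x := by
    intro x h0 h1
    exact (((hU x h0 h1).mul (hv x h0 h1)).sub ((hu x h0 h1).mul (hV x h0 h1))).congr_deriv
      (by ring)
  have hW0 : ∀ x, 0 < x → x < b → u' x * v x - u x * v' x = 0 := by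
    intro x h0 h1
    obtain ⟨c, hc, hc2⟩ := exists_hasDerivAt_eq_slope
      (fun y => P y * u' y * v y - u y * (P y * v' y)) (fun _ => 0) h0
      (fun y hy => (hW y hy.1 (hy.2.trans_lt h1)).continuousAt.continuousWithinAt)
      (fun y hy => hW y hy.1.le (hy.2.trans h1))
    have h2 : x - 0 ≠ 0 := by linarith
    rw [eq_div_iff h2] at hc2
    simp only [hP0] at hc2
    have h3 : P x * (u' x * v x - u x * v' x) = 0 := by linear_combination -hc2
    exact (mul_eq_zero.1 h3).resolve_left (hP x h0 h1)
  intro x h0 h1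
  rcases h0.eq_or_lt with h | h0
  · rw [← h, huv]
  have hq : ∀ y, 0 ≤ y → y < b → HasDerivAt (fun y => u y / v y)
      ((u' y * v y - u y * v' y) / (v y) ^ 2) y := fun y h0 h1 =>
    (hu y h0 h1).div (hv y h0 h1) (hvpos y h0 h1)
  obtain ⟨c, hc, hc2⟩ := exists_hasDerivAt_eq_slope
      (fun y => u y / v y) _ h0
      (fun y hy => (hq y hy.1 (hy.2.trans_lt h1)).continuousAt.continuousWithinAt)
      (fun y hy => hq y hy.1.le (hy.2.trans h1))
  have h2 : x - 0 ≠ 0 := by linarith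
  rw [eq_div_iff h2, hW0 c hc.1 (hc.2.trans h1), huv, div_self (hvpos 0 le_rfl (h0.trans h1))] at hc2
  have h3 : u x / v x = 1 := by linear_combination -hc2
  rwa [div_eq_one_iff_eq (hvpos x h0.le h1)] at h3

theorem abel {a : ℕ → ℝ} (h : PB a) {l : ℝ} (hl : Tendsto a atTop (𝓝 l)) :
    Tendsto (fun x => (1 - x) * ps a x) (𝓝[<] 1) (𝓝 l) := by
  let f : ℕ → ℝ := fun n => a n - (if n = 0 then 0 else a (n - 1))
  have hs : ∀ n, ∑ i ∈ Finset.range (n + 1), f i = a n := by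
    intro n
    induction n with
    | zero => simp [f]
    | succ n ih => rw [Finset.sum_range_succ, ih]; simp [f]
  have h1 : Tendsto (fun n ↦ ∑ i ∈ Finset.range n, f i) atTop (𝓝 l) := by
    rw [← tendsto_add_atTop_iff_nat 1]
    simpa only [hs] using hl
  have h2 := Real.tendsto_tsum_powerSeries_nhdsWithin_lt h1
  refine h2.congr' ?_
  have : Ioo (0 : ℝ) 1 ∈ 𝓝[<] (1 : ℝ) := Ioo_mem_nhdsLT (by norm_num)
  filter_upwards [this] with x hx
  have hx1 : |x| < 1 := by rw [abs_of_pos hx.1]; exact hx.2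
  have s := h.sm hx1
  have s2 : Summable (fun n => (if n = 0 then 0 else a (n - 1)) * x ^ n) := by
    rw [← summable_nat_add_iff 1]
    refine (s.mul_left x).congr (fun n => ?_)
    simp
    ring
  have e : ∑' n : ℕ, (if n = 0 then 0 else a (n - 1)) * x ^ n = x * ps a x := by
    rw [s2.tsum_eq_zero_add]
    unfold ps
    rw [← tsum_mul_left]
    simp
    congr 1
    ext n
    ring
  calc ∑' n, f n * x ^ n = ∑' n, (a n * x ^ n - (if n = 0 then 0 else a (n - 1)) * x ^ n) := by
        congr 1; ext n; simp only [f]; ring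
    _ = ps a x - x * ps a x := by rw [s.tsum_sub s2, e]; rfl
    _ = _ := by ring

theorem poch_zero (a : ℝ) : poch a 0 = 1 := by simp [poch]

theorem poch_succ (a : ℝ) (n : ℕ) : poch a (n + 1) = poch a n * (a + n) := by
  unfold poch
  rw [ascPochhammer_succ_eval]

theorem poch_pos {a : ℝ} (ha : 0 < a) (n : ℕ) : 0 < poch a n := by
  induction n with
  | zero => simp [poch_zero]
  | succ n ih => rw [poch_succ]; positivity

theorem poch_le {a : ℝ} (ha : 0 < a) (h1 : a ≤ 1) (n : ℕ) : poch a n ≤ poch 1 n := by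
  induction n with
  | zero => simp [poch_zero]
  | succ n ih =>
    rw [poch_succ, poch_succ]
    have := poch_pos ha n
    have h2 := poch_pos one_pos n
    gcongr

noncomputable def hg (a b : ℝ) (n : ℕ) : ℝ := poch a n * poch b n / (poch 1 n) ^ 2

theorem hg_zero (a b : ℝ) : hg a b 0 = 1 := by simp [hg, poch_zero]

theorem hg_succ (a b : ℝ) (n : ℕ) :
    ((n : ℝ) + 1) ^ 2 * hg a b (n + 1) = (a + n) * (b + n) * hg a b n := by
  have := (poch_pos one_pos n).ne'
  have h : (1 : ℝ) + n ≠ 0 := by positivity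
  unfold hg
  simp only [poch_succ]
  field_simp
  ring

theorem hg_nonneg {a b : ℝ} (ha : 0 < a) (hb : 0 < b) (n : ℕ) : 0 ≤ hg a b n := by
  have := poch_pos ha n
  have := poch_pos hb n
  unfold hg
  positivity

theorem hg_le {a b : ℝ} (ha : 0 < a) (hb : 0 < b) (ha1 : a ≤ 1) (hb1 : b ≤ 1) (n : ℕ) :
    hg a b n ≤ 1 := by
  have h1 := poch_pos ha n
  have h2 := poch_pos hb n
  have h3 := poch_pos one_pos n
  unfold hg
  rw [div_le_one (by positivity), sq]
  exact mul_le_mul (poch_le ha ha1 n) (poch_le hb hb1 n) h2.le h3.le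

theorem hg_PB {a b : ℝ} (ha : 0 < a) (hb : 0 < b) (ha1 : a ≤ 1) (hb1 : b ≤ 1) : PB (hg a b) :=
  PB.of_le_one (hg_nonneg ha hb) (hg_le ha hb ha1 hb1)

noncomputable def tt (n : ℕ) : ℝ := (poch (1/2) n * poch (1/3) n * poch (2/3) n) / (poch 1 n)^3

theorem tt_succ (n : ℕ) :
    ((n : ℝ) + 1) ^ 3 * tt (n + 1) = (1/2 + n) * (1/3 + n) * (2/3 + n) * tt n := by
  have := (poch_pos one_pos n).ne'
  have h : (1 : ℝ) + n ≠ 0 := by positivity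
  unfold tt
  simp only [poch_succ]
  field_simp
  ring

theorem tt_PB : PB tt := by
  apply PB.of_le_one
  · intro n
    have h1 := poch_pos (a := 1/2) (by norm_num) n
    have h2 := poch_pos (a := 1/3) (by norm_num) n
    have h3 := poch_pos (a := 2/3) (by norm_num) n
    have h4 := poch_pos one_pos n
    unfold tt
    positivity
  · intro n
    have h1 := poch_pos (a := 1/2) (by norm_num) n
    have h2 := poch_pos (a := 1/3) (by norm_num) n
    have h3 := poch_pos (a := 2/3) (by norm_num) n
    have h4 := poch_pos one_pos n
    have h5 := poch_le (a := 1/2) (by norm_num) (by norm_num) n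
    have h6 := poch_le (a := 1/3) (by norm_num) (by norm_num) n
    have h7 := poch_le (a := 2/3) (by norm_num) (by norm_num) n
    unfold tt
    rw [div_le_one (by positivity)]
    calc _ ≤ poch 1 n * poch 1 n * poch 1 n := by gcongr
      _ = _ := by ring

noncomputable def th (f : PowerSeries ℝ) : PowerSeries ℝ :=
  PowerSeries.X * PowerSeries.derivative ℝ f

theorem coeff_th (f : PowerSeries ℝ) (n : ℕ) :
    PowerSeries.coeff n (th f) = n * PowerSeries.coeff n f := by
  unfold th
  cases n with
  | zero => simp
  | succ n => rw [PowerSeries.coeff_succ_X_mul, PowerSeries.coeff_derivative]; push_cast; ring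

theorem th_mul (f g : PowerSeries ℝ) : th (f * g) = f * th g + g * th f := by
  unfold th
  simp only [Derivation.leibniz, smul_eq_mul]
  ring

theorem th_add (f g : PowerSeries ℝ) : th (f + g) = th f + th g := by
  unfold th
  rw [map_add]
  ring

theorem th_X : th PowerSeries.X = PowerSeries.X := by
  ext n
  rw [coeff_th, PowerSeries.coeff_X]
  split_ifs with h
  · simp [h]
  · simp

theorem th_C (c : ℝ) : th (PowerSeries.C c) = 0 := by
  ext n
  rw [coeff_th, PowerSeries.coeff_C]
  split_ifs with h
  · simp [h]
  · simp

theorem clausen_coeff (n : ℕ) :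
    ∑ kl ∈ Finset.HasAntidiagonal.antidiagonal n, hg (1/6) (1/3) kl.1 * hg (1/6) (1/3) kl.2 = tt n := by
  set g : PowerSeries ℝ := PowerSeries.mk (hg (1/6) (1/3)) with hgdef
  have hc : ∀ n, PowerSeries.coeff n (g * g) =
      ∑ kl ∈ Finset.HasAntidiagonal.antidiagonal n, hg (1/6) (1/3) kl.1 * hg (1/6) (1/3) kl.2 := by
    intro n
    rw [PowerSeries.coeff_mul]
    simp [hgdef]
  rw [← hc]
  have E2 : th (th g) = PowerSeries.X * (th (th g) + PowerSeries.C (1/2) * th g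
      + PowerSeries.C (1/18) * g) := by
    ext n
    cases n with
    | zero => simp [coeff_th]
    | succ n =>
      rw [PowerSeries.coeff_succ_X_mul]
      simp only [map_add, PowerSeries.coeff_C_mul, coeff_th, hgdef, PowerSeries.coeff_mk]
      have := hg_succ (1/6) (1/3) n
      push_cast
      linear_combination this
  have E3 : th (th (th g)) = PowerSeries.X * (th (th g) + PowerSeries.C (1/2) * th g
      + PowerSeries.C (1/18) * g) + PowerSeries.X * (th (th (th g)) + PowerSeries.C (1/2) * th (th g)
      + PowerSeries.C (1/18) * th g) := by
    conv_lhs => rw [E2]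
    simp only [th_mul, th_add, th_X, th_C]
    ring
  have hC : ∀ q : ℝ, ∀ m : ℕ, PowerSeries.C (m * q) = (m : PowerSeries ℝ) * PowerSeries.C q := by
    intro q m
    simp
  have c1 : PowerSeries.C (1/2 : ℝ) = 9 * PowerSeries.C (1/18) := by
    rw [← Nat.cast_ofNat (n := 9), ← hC]; norm_num
  have c2 : PowerSeries.C (3/2 : ℝ) = 27 * PowerSeries.C (1/18) := by
    rw [← Nat.cast_ofNat (n := 27), ← hC]; norm_num
  have c3 : PowerSeries.C (13/18 : ℝ) = 13 * PowerSeries.C (1/18) := by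
    rw [show (13/18 : ℝ) = ((13 : ℕ) : ℝ) * (1/18) by norm_num, hC]; norm_num
  have c4 : PowerSeries.C (1/9 : ℝ) = 2 * PowerSeries.C (1/18) := by
    rw [← Nat.cast_ofNat (n := 2), ← hC]; norm_num
  have c5 : 18 * PowerSeries.C (1/18 : ℝ) = 1 := by
    rw [← Nat.cast_ofNat (n := 18), ← hC]; norm_num
  have E : th (th (th (g * g))) = PowerSeries.X * (th (th (th (g * g)))
      + PowerSeries.C (3/2) * th (th (g * g)) + PowerSeries.C (13/18) * th (g * g)
      + PowerSeries.C (1/9) * (g * g)) := by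
    simp only [th_mul, th_add]
    rw [c1] at E2 E3
    rw [c2, c3, c4]
    generalize PowerSeries.C (1/18 : ℝ) = c at *
    generalize th (th (th g)) = g3 at *
    generalize th (th g) = g2 at *
    generalize th g = g1 at *
    generalize (PowerSeries.X : PowerSeries ℝ) = X at *
    linear_combination 6 * g1 * E2 + 2 * g * E3 + X * (-2 * g * g2) * c5
  have hrec : ∀ n : ℕ, ((n : ℝ) + 1) ^ 3 * PowerSeries.coeff (n + 1) (g * g) =
      (1/2 + n) * (1/3 + n) * (2/3 + n) * PowerSeries.coeff n (g * g) := by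
    intro n
    have h := congrArg (PowerSeries.coeff (n + 1)) E
    rw [PowerSeries.coeff_succ_X_mul] at h
    simp only [map_add, PowerSeries.coeff_C_mul, coeff_th] at h
    push_cast at h
    linear_combination h
  induction n with
  | zero => rw [hc]; simp [hg_zero, tt, poch_zero]
  | succ n ih =>
    have h1 := hrec n
    have h2 := tt_succ n
    rw [ih, ← h2] at h1
    exact mul_left_cancel₀ (by positivity) h1

theorem clausen {x : ℝ} (hx : |x| < 1) : ps (hg (1/6) (1/3)) x ^ 2 = ps tt x := by
  have h := (hg_PB (a := 1/6) (b := 1/3) (by norm_num) (by norm_num) (by norm_num)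
    (by norm_num)).summable hx
  unfold ps
  rw [sq, tsum_mul_tsum_eq_tsum_sum_antidiagonal_of_summable_norm h h]
  congr 1
  ext n
  rw [← clausen_coeff, Finset.sum_mul]
  refine Finset.sum_congr rfl (fun kl hkl => ?_)
  rw [← Finset.HasAntidiagonal.mem_antidiagonal.1 hkl, pow_add]
  ring

noncomputable def F0 : ℝ → ℝ := ps (hg (1/3) (2/3))
noncomputable def F1 : ℝ → ℝ := ps (dd (hg (1/3) (2/3)))
noncomputable def F2 : ℝ → ℝ := ps (dd (dd (hg (1/3) (2/3))))
noncomputable def G0 : ℝ → ℝ := ps (hg (1/6) (1/3))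
noncomputable def G1 : ℝ → ℝ := ps (dd (hg (1/6) (1/3)))
noncomputable def G2 : ℝ → ℝ := ps (dd (dd (hg (1/6) (1/3))))

theorem PBF : PB (hg (1/3) (2/3)) :=
  hg_PB (by norm_num) (by norm_num) (by norm_num) (by norm_num)
theorem PBG : PB (hg (1/6) (1/3)) :=
  hg_PB (by norm_num) (by norm_num) (by norm_num) (by norm_num)

theorem F0_deriv {x : ℝ} (hx : |x| < 1) : HasDerivAt F0 (F1 x) x := PBF.hasDeriv hx
theorem F1_deriv {x : ℝ} (hx : |x| < 1) : HasDerivAt F1 (F2 x) x := PBF.dd.hasDeriv hx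
theorem G0_deriv {x : ℝ} (hx : |x| < 1) : HasDerivAt G0 (G1 x) x := PBG.hasDeriv hx
theorem G1_deriv {x : ℝ} (hx : |x| < 1) : HasDerivAt G1 (G2 x) x := PBG.dd.hasDeriv hx

theorem F_ode {x : ℝ} (hx : |x| < 1) :
    x * (1 - x) * F2 x + (1 - 2 * x) * F1 x = 2/9 * F0 x := by
  have := ps_ode PBF (s := 1) (t := 2/9) (fun n => by rw [hg_succ]; ring) hx
  unfold F0 F1 F2
  linear_combination this

theorem G_ode {x : ℝ} (hx : |x| < 1) :
    x * (1 - x) * G2 x + (1 - 3/2 * x) * G1 x = 1/18 * G0 x := by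
  have := ps_ode PBG (s := 1/2) (t := 1/18) (fun n => by rw [hg_succ]; ring) hx
  unfold G0 G1 G2
  linear_combination this

noncomputable def UU (x : ℝ) : ℝ := x * (1 - x) * F1 x

theorem UU_deriv {x : ℝ} (hx : |x| < 1) : HasDerivAt UU (2/9 * F0 x) x := by
  have h1 : HasDerivAt (fun y : ℝ => y * (1 - y)) (1 - 2 * x) x :=
    ((hasDerivAt_id x).mul ((hasDerivAt_id x).const_sub 1)).congr_deriv (by simp; ring)
  exact (h1.mul (F1_deriv hx)).congr_deriv (by rw [← F_ode hx]; ring)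

theorem F0_zero : F0 0 = 1 := by unfold F0; rw [ps_zero, hg_zero]
theorem G0_zero : G0 0 = 1 := by unfold G0; rw [ps_zero, hg_zero]
theorem F0_pos {x : ℝ} (h0 : 0 ≤ x) (h1 : x < 1) : 0 < F0 x :=
  ps_pos PBF (hg_nonneg (by norm_num) (by norm_num)) (hg_zero _ _) h0 h1
theorem G0_pos {x : ℝ} (h0 : 0 ≤ x) (h1 : x < 1) : 0 < G0 x :=
  ps_pos PBG (hg_nonneg (by norm_num) (by norm_num)) (hg_zero _ _) h0 h1

theorem quadz_deriv (x : ℝ) : HasDerivAt (fun y : ℝ => 4 * y * (1 - y)) (4 * (1 - 2 * x)) x :=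
  (((hasDerivAt_id x).const_mul 4).mul ((hasDerivAt_id x).const_sub 1)).congr_deriv
    (by simp; ring)

theorem quadz_mem {x : ℝ} (h0 : 0 ≤ x) (h1 : x < 1/2) :
    0 ≤ 4 * x * (1 - x) ∧ 4 * x * (1 - x) < 1 := by
  constructor
  · have : 0 ≤ 1 - x := by linarith
    positivity
  · nlinarith [sq_pos_of_pos (by linarith : 0 < 1 - 2 * x)]

theorem quad {x : ℝ} (h0 : 0 ≤ x) (h1 : x < 1/2) : F0 x = G0 (4 * x * (1 - x)) := by
  refine ode_unique (u := F0) (v := fun x => G0 (4 * x * (1 - x))) (u' := F1)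
    (v' := fun x => G1 (4 * x * (1 - x)) * (4 * (1 - 2 * x))) (P := fun x => x * (1 - x))
    (Q := fun _ => 2/9) (b := 1/2) ?_ ?_ ?_ ?_ ?_ ?_ ?_ ?_ x h0 h1
  · intro x h0 h1
    exact F0_deriv (by rw [abs_of_nonneg h0]; linarith)
  · intro x h0 h1
    obtain ⟨h2, h3⟩ := quadz_mem h0 h1
    exact (G0_deriv (by rw [abs_of_nonneg h2]; exact h3)).comp x (quadz_deriv x)
  · intro x h0 h1
    exact UU_deriv (by rw [abs_of_nonneg h0]; linarith)
  · intro x h0 h1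
    obtain ⟨h2, h3⟩ := quadz_mem h0 h1
    have h4 : |4 * x * (1 - x)| < 1 := by rw [abs_of_nonneg h2]; exact h3
    have d1 := (G1_deriv h4).comp x (quadz_deriv x)
    have d2 : HasDerivAt (fun y : ℝ => 4 * (1 - 2 * y)) (-8) x :=
      ((((hasDerivAt_id x).const_mul 2).const_sub 1).const_mul 4).congr_deriv (by norm_num)
    have d3 : HasDerivAt (fun y : ℝ => y * (1 - y)) (1 - 2 * x) x :=
      ((hasDerivAt_id x).mul ((hasDerivAt_id x).const_sub 1)).congr_deriv (by simp; ring)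
    refine (d3.mul (d1.mul d2)).congr_deriv ?_
    have := G_ode h4
    simp only [Function.comp_apply, Pi.mul_apply]
    linear_combination 4 * this
  · simp
  · intro x h0 h1
    have : 0 < 1 - x := by linarith
    positivity
  · intro x h0 h1
    obtain ⟨h2, h3⟩ := quadz_mem h0 h1
    exact (G0_pos h2 h3).ne'
  · simp [F0_zero, G0_zero]

theorem F_sq {x : ℝ} (h0 : 0 ≤ x) (h1 : x < 1/2) : F0 x ^ 2 = ps tt (4 * x * (1 - x)) := by
  obtain ⟨h2, h3⟩ := quadz_mem h0 h1
  rw [quad h0 h1]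
  exact clausen (by rw [abs_of_nonneg h2]; exact h3)

/-! The quadratic modular equation in the cubic theory. -/

noncomputable def al (p : ℝ) : ℝ := p * (3 + p) ^ 2 / (2 * (1 + p) ^ 3)
noncomputable def al' (p : ℝ) : ℝ := 3 * (1 - p) * (3 + p) / (2 * (1 + p) ^ 4)
noncomputable def be (p : ℝ) : ℝ := p ^ 2 * (3 + p) / 4
noncomputable def be' (p : ℝ) : ℝ := 3 * p * (p + 2) / 4
noncomputable def PP (p : ℝ) : ℝ := p * (3 + p) * (1 - p) * (2 + p) / (6 * (1 + p) ^ 2)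

theorem al_deriv {p : ℝ} (hp : 0 ≤ p) : HasDerivAt al (al' p) p := by
  have h1 : (1 : ℝ) + p ≠ 0 := by positivity
  have d1 := (hasDerivAt_id p).const_add 3
  have d2 := (hasDerivAt_id p).const_add 1
  refine (((hasDerivAt_id p).mul (d1.pow 2)).div ((d2.pow 3).const_mul 2)
    (by simpa using h1)).congr_deriv ?_
  unfold al'
  simp
  field_simp
  ring

theorem be_deriv (p : ℝ) : HasDerivAt be (be' p) p := by
  have d1 := (hasDerivAt_id p).const_add 3
  refine ((((hasDerivAt_id p).pow 2).mul d1).div_const 4).congr_deriv ?_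
  unfold be'
  simp
  ring

theorem PP_deriv {p : ℝ} (hp : 0 ≤ p) :
    HasDerivAt PP (2/9 * (al' p * (1 + p) - 2 * be' p / (1 + p))) p := by
  have h1 : (1 : ℝ) + p ≠ 0 := by positivity
  have d1 := (hasDerivAt_id p).const_add 3
  have d2 := (hasDerivAt_id p).const_add 1
  have d3 := (hasDerivAt_id p).const_sub 1
  have d4 := (hasDerivAt_id p).const_add 2
  refine (((((hasDerivAt_id p).mul d1).mul d3).mul d4).div ((d2.pow 2).const_mul 6)
    (by simpa using h1)).congr_deriv ?_
  unfold al' be'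
  simp
  field_simp
  ring

theorem al_mem {p : ℝ} (h0 : 0 ≤ p) (h1 : p < 1) : 0 ≤ al p ∧ al p < 1 := by
  have h2 : 0 < 1 - p := by linarith
  constructor
  · unfold al; positivity
  · have : 1 - al p = (1 - p) ^ 2 * (2 + p) / (2 * (1 + p) ^ 3) := by
      unfold al
      field_simp
      ring
    have h3 : 0 < (1 - p) ^ 2 * (2 + p) / (2 * (1 + p) ^ 3) := by positivity
    linarith

theorem be_mem {p : ℝ} (h0 : 0 ≤ p) (h1 : p < 1) : 0 ≤ be p ∧ be p < 1 := by
  have h2 : 0 < 1 - p := by linarith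
  constructor
  · unfold be; positivity
  · have : 1 - be p = (1 - p) * (2 + p) ^ 2 / 4 := by
      unfold be
      ring
    have h3 : 0 < (1 - p) * (2 + p) ^ 2 / 4 := by positivity
    linarith

theorem al_abs {p : ℝ} (h0 : 0 ≤ p) (h1 : p < 1) : |al p| < 1 := by
  rw [abs_of_nonneg (al_mem h0 h1).1]; exact (al_mem h0 h1).2

theorem be_abs {p : ℝ} (h0 : 0 ≤ p) (h1 : p < 1) : |be p| < 1 := by
  rw [abs_of_nonneg (be_mem h0 h1).1]; exact (be_mem h0 h1).2

theorem lhs_deriv {p : ℝ} (h0 : 0 ≤ p) (h1 : p < 1) :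
    HasDerivAt (fun p => F0 (al p)) (F1 (al p) * al' p) p :=
  (F0_deriv (al_abs h0 h1)).comp p (al_deriv h0)

theorem rhs_deriv {p : ℝ} (h0 : 0 ≤ p) (h1 : p < 1) :
    HasDerivAt (fun p => (1 + p) * F0 (be p)) (F0 (be p) + (1 + p) * (F1 (be p) * be' p)) p :=
  (((hasDerivAt_id p).const_add 1).mul
    ((F0_deriv (be_abs h0 h1)).comp p (be_deriv p))).congr_deriv (by simp)

theorem modular {p : ℝ} (h0 : 0 ≤ p) (h1 : p < 1) : F0 (al p) = (1 + p) * F0 (be p) := by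
  refine ode_unique (u := fun p => F0 (al p)) (v := fun p => (1 + p) * F0 (be p))
    (u' := fun p => F1 (al p) * al' p)
    (v' := fun p => F0 (be p) + (1 + p) * (F1 (be p) * be' p)) (P := PP)
    (Q := fun p => 2/9 * al' p) (b := 1) ?_ ?_ ?_ ?_ ?_ ?_ ?_ ?_ p h0 h1
  · intro p h0 h1
    exact lhs_deriv h0 h1
  · intro p h0 h1
    exact rhs_deriv h0 h1
  · intro p h0 h1
    have d : HasDerivAt (fun y => UU (al y)) (2/9 * F0 (al p) * al' p) p :=
      (UU_deriv (al_abs h0 h1)).comp p (al_deriv h0)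
    refine (d.congr_of_eventuallyEq ?_).congr_deriv (by ring)
    have : Ioi (-1 : ℝ) ∈ 𝓝 p := Ioi_mem_nhds (by linarith)
    filter_upwards [this] with y hy
    have hy : (1 : ℝ) + y ≠ 0 := by
      have : -1 < y := hy
      linarith
    unfold UU
    generalize F1 (al y) = f
    unfold PP al al'
    field_simp
    ring
  · intro p h0 h1
    have hp : (1 : ℝ) + p ≠ 0 := by positivity
    have d1 : HasDerivAt (fun y => UU (be y)) (2/9 * F0 (be p) * be' p) p :=
      (UU_deriv (be_abs h0 h1)).comp p (be_deriv p)
    have d2 : HasDerivAt (fun y => F0 (be y)) (F1 (be p) * be' p) p :=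
      (F0_deriv (be_abs h0 h1)).comp p (be_deriv p)
    have d3 : HasDerivAt (fun y : ℝ => 2 / (1 + y)) (-2 / (1 + p) ^ 2) p :=
      ((hasDerivAt_const p (2 : ℝ)).div ((hasDerivAt_id p).const_add 1) hp).congr_deriv (by simp)
    have d := ((PP_deriv h0).mul d2).add (d3.mul d1)
    refine (d.congr_of_eventuallyEq ?_).congr_deriv ?_
    · have : Ioi (-1 : ℝ) ∈ 𝓝 p := Ioi_mem_nhds (by linarith)
      filter_upwards [this] with y hy
      have hy : (1 : ℝ) + y ≠ 0 := by
        have : -1 < y := hy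
        linarith
      simp only [Pi.add_apply, Pi.mul_apply]
      unfold UU
      generalize F1 (be y) = f
      generalize F0 (be y) = f0
      unfold PP be be'
      field_simp
      ring
    · unfold UU
      generalize F1 (be p) = f
      generalize F0 (be p) = f0
      unfold PP be be'
      generalize al' p = w
      field_simp
      ring
  · simp [PP]
  · intro p h0 h1
    have : 0 < 1 - p := by linarith
    unfold PP
    positivity
  · intro p h0 h1
    have := F0_pos (be_mem h0 h1).1 (be_mem h0 h1).2
    positivity
  · simp [al, be]

theorem modular_deriv {p : ℝ} (h0 : 0 < p) (h1 : p < 1) :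
    F1 (al p) * al' p = F0 (be p) + (1 + p) * (F1 (be p) * be' p) := by
  refine (lhs_deriv h0.le h1).unique ((rhs_deriv h0.le h1).congr_of_eventuallyEq ?_)
  filter_upwards [Ioo_mem_nhds h0 h1] with y hy
  exact modular hy.1.le hy.2

theorem F_sq_deriv {x : ℝ} (h0 : 0 < x) (h1 : x < 1/2) :
    2 * F0 x * F1 x = ps (dd tt) (4 * x * (1 - x)) * (4 * (1 - 2 * x)) := by
  obtain ⟨h2, h3⟩ := quadz_mem h0.le h1
  have d1 : HasDerivAt (fun x => ps tt (4 * x * (1 - x)))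
      (ps (dd tt) (4 * x * (1 - x)) * (4 * (1 - 2 * x))) x :=
    (tt_PB.hasDeriv (by rw [abs_of_nonneg h2]; exact h3)).comp x (quadz_deriv x)
  have d2 := (F0_deriv (x := x) (by rw [abs_of_pos h0]; linarith)).pow 2
  have d3 : HasDerivAt (fun x => F0 x ^ 2) (2 * F0 x * F1 x) x := d2.congr_deriv (by simp)
  refine d3.unique (d1.congr_of_eventuallyEq ?_)
  filter_upwards [Ioo_mem_nhds h0 h1] with y hy
  exact F_sq hy.1.le hy.2

/-! Legendre-type relation -/

theorem coeff_lim : Tendsto (dd (hg (1/3) (2/3))) atTop (𝓝 (√3 / (2 * π))) := by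
  have hprod : ∀ (s : ℝ) (n : ℕ), ∏ j ∈ Finset.range (n + 1), (s + j) = poch s n * (s + n) := by
    intro s n
    induction n with
    | zero => simp [poch_zero]
    | succ n ih => rw [Finset.prod_range_succ, ih, poch_succ]
  have hfac : ∀ n : ℕ, (n.factorial : ℝ) = poch 1 n := by
    intro n
    induction n with
    | zero => simp [poch_zero]
    | succ n ih => rw [Nat.factorial_succ, poch_succ, ← ih]; push_cast; ring
  have hG := (Real.GammaSeq_tendsto_Gamma (1/3)).mul (Real.GammaSeq_tendsto_Gamma (1 - 1/3))
  rw [Real.Gamma_mul_Gamma_one_sub] at hG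
  have hs : Real.sin (π * (1/3)) = √3 / 2 := by
    rw [← Real.sin_pi_div_three]; congr 1; ring
  rw [hs] at hG
  have h3 : (0 : ℝ) < √3 := by positivity
  have hinv := hG.inv₀ (by positivity)
  have hn := tendsto_natCast_div_add_atTop (1 : ℝ)
  have h := hn.mul hinv
  have e : 1 * (π / (√3 / 2))⁻¹ = √3 / (2 * π) := by
    field_simp
  rw [e] at h
  refine h.congr' ?_
  filter_upwards [eventually_gt_atTop 0] with n hn
  have hn : (0 : ℝ) < n := by exact_mod_cast hn
  have hp : (n : ℝ) ^ (1/3 : ℝ) * (n : ℝ) ^ (1 - 1/3 : ℝ) = n := by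
    rw [← Real.rpow_add hn]; norm_num
  have hd : dd (hg (1/3) (2/3)) n = (1/3 + n) * (2/3 + n) * hg (1/3) (2/3) n / (n + 1) := by
    rw [← hg_succ]
    unfold dd
    field_simp
  have hGG : Real.GammaSeq (1/3) n * Real.GammaSeq (1 - 1/3) n =
      n * (poch 1 n) ^ 2 / ((poch (1/3) n * (1/3 + n)) * (poch (2/3) n * (2/3 + n))) := by
    unfold Real.GammaSeq
    rw [hprod, hprod, hfac, show (1 - 1/3 : ℝ) = 2/3 by norm_num] at *
    rw [div_mul_div_comm]
    congr 1
    linear_combination (poch 1 n) ^ 2 * hp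
  rw [hGG, hd]
  unfold hg
  have h1 := (poch_pos (a := 1/3) (by norm_num) n).ne'
  have h2 := (poch_pos (a := 2/3) (by norm_num) n).ne'
  have h4 := (poch_pos (a := 1) (by norm_num) n).ne'
  field_simp

theorem coeff_lim0 : Tendsto (hg (1/3) (2/3)) atTop (𝓝 0) := by
  rw [← tendsto_add_atTop_iff_nat 1]
  have h := coeff_lim.mul (tendsto_one_div_add_atTop_nhds_zero_nat (𝕜 := ℝ))
  rw [mul_zero] at h
  refine h.congr (fun n => ?_)
  unfold dd
  field_simp

theorem wronskian {x : ℝ} (h0 : 0 < x) (h1 : x < 1) :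
    UU (1 - x) * F0 x + F0 (1 - x) * UU x = √3 / (2 * π) := by
  set W : ℝ → ℝ := fun x => UU (1 - x) * F0 x + F0 (1 - x) * UU x with hW
  have dW : ∀ y ∈ Ioo (0 : ℝ) 1, HasDerivAt W 0 y := by
    intro y hy
    have a1 : |y| < 1 := by rw [abs_of_pos hy.1]; exact hy.2
    have a2 : |1 - y| < 1 := by rw [abs_of_pos (by linarith [hy.2])]; linarith [hy.1]
    have d0 : HasDerivAt (fun y : ℝ => 1 - y) (-1) y := (hasDerivAt_id y).const_sub 1
    have d1 : HasDerivAt (fun y => UU (1 - y)) (2/9 * F0 (1 - y) * (-1)) y :=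
      (UU_deriv a2).comp y d0
    have d2 : HasDerivAt (fun y => F0 (1 - y)) (F1 (1 - y) * (-1)) y := (F0_deriv a2).comp y d0
    refine ((d1.mul (F0_deriv a1)).add (d2.mul (UU_deriv a1))).congr_deriv ?_
    unfold UU
    ring
  have hconst : ∀ y ∈ Ioo (0 : ℝ) 1, W y = W x := by
    intro y hy
    refine (convex_Ioo (0 : ℝ) 1).is_const_of_fderivWithin_eq_zero (𝕜 := ℝ)
      (fun z hz => (dW z hz).differentiableAt.differentiableWithinAt) (fun z hz => ?_) hy ⟨h0, h1⟩
    rw [fderivWithin_of_isOpen isOpen_Ioo hz]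
    have := (dW z hz).hasFDerivAt.fderiv
    rw [this]
    ext
    simp
  have hlim : Tendsto W (𝓝[>] 0) (𝓝 (√3 / (2 * π))) := by
    have c0 : Tendsto F0 (𝓝[>] 0) (𝓝 1) := by
      have := (F0_deriv (x := 0) (by simp)).continuousAt.tendsto
      rw [F0_zero] at this
      exact this.mono_left nhdsWithin_le_nhds
    have c1 : Tendsto F1 (𝓝[>] 0) (𝓝 (F1 0)) :=
      ((F1_deriv (x := 0) (by simp)).continuousAt.tendsto).mono_left nhdsWithin_le_nhds
    have c2 : Tendsto (fun y : ℝ => 1 - y) (𝓝[>] 0) (𝓝 1) := by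
      have : Continuous (fun y : ℝ => 1 - y) := by fun_prop
      have := this.tendsto 0
      rw [sub_zero] at this
      exact this.mono_left nhdsWithin_le_nhds
    have c3 : Tendsto (fun y : ℝ => 1 - y) (𝓝[>] 0) (𝓝[<] 1) := by
      refine tendsto_nhdsWithin_iff.2 ⟨c2, ?_⟩
      filter_upwards [self_mem_nhdsWithin] with y hy
      have : 0 < y := hy
      simp only [mem_Iio]
      linarith
    have l1 := (abel PBF.dd coeff_lim).comp c3
    have l2 := (abel PBF coeff_lim0).comp c3
    have l := ((l1.mul c2).mul c0).add ((l2.mul c2).mul c1)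
    have e : √3 / (2 * π) * 1 * 1 + 0 * 1 * F1 0 = √3 / (2 * π) := by ring
    rw [e] at l
    refine l.congr (fun y => ?_)
    simp only [Function.comp_apply, hW, UU]
    change (1 - (1 - y)) * F1 (1 - y) * (1 - y) * F0 y + (1 - (1 - y)) * F0 (1 - y) * (1 - y) * F1 y = _
    ring
  have hlim2 : Tendsto W (𝓝[>] 0) (𝓝 (W x)) := by
    refine tendsto_const_nhds.congr' ?_
    filter_upwards [Ioo_mem_nhdsGT (zero_lt_one (α := ℝ))] with y hy
    exact (hconst y hy).symm
  exact tendsto_nhds_unique hlim2 hlim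

theorem stmt_0 :
    ∑' n : ℕ, (poch (1/2) n * poch (1/3) n * poch (2/3) n) / (poch 1 n)^3 * (6*(n:ℝ)+1) * ((1:ℝ)/2)^n = 3 * Real.sqrt 3 / π := by
  have hh : |(1/2 : ℝ)| < 1 := by rw [abs_of_pos] <;> norm_num
  have e1 : ∑' n : ℕ, (poch (1/2) n * poch (1/3) n * poch (2/3) n) / (poch 1 n)^3 * (6*(n:ℝ)+1) * ((1:ℝ)/2)^n
      = 3 * ps (dd tt) (1/2) + ps tt (1/2) := by
    have := x_mul_ps tt_PB hh
    calc _ = ∑' n : ℕ, (6 * ((n : ℝ) * tt n * (1/2) ^ n) + tt n * (1/2) ^ n) := by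
          congr 1; ext n; unfold tt; ring
      _ = 6 * ps (fun n => (n : ℝ) * tt n) (1/2) + ps tt (1/2) := by
          rw [((tt_PB.mul_nat.sm hh).mul_left 6).tsum_add (tt_PB.sm hh), tsum_mul_left]
          rfl
      _ = _ := by rw [this]; ring
  rw [e1]
  obtain ⟨r, hr⟩ : ∃ r, r = √2 := ⟨_, rfl⟩
  have hr2 : r ^ 2 = 2 := by rw [hr]; exact Real.sq_sqrt (by norm_num)
  have hr0 : 0 < r := by rw [hr]; positivity
  have hr1 : 1 < r := by nlinarith
  have hr3 : r < 2 := by nlinarith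
  set x := (2 - r) / 4 with hx
  have hx0 : 0 < x := by linarith
  have hx1 : x < 1/2 := by linarith
  have hz : 4 * x * (1 - x) = 1/2 := by
    rw [hx]; linear_combination (-1/4) * hr2
  have hbe : be (r - 1) = x := by
    unfold be; rw [hx]; linear_combination (r / 4) * hr2
  have hal : al (r - 1) = 1 - x := by
    unfold al
    rw [div_eq_iff (by ring_nf; positivity), hx]
    ring_nf
    have h3 : r ^ 3 = 2 * r := by linear_combination r * hr2
    have h4 : r ^ 4 = 4 := by linear_combination (r ^ 2 + 2) * hr2
    rw [h3, h4, hr2]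
    ring
  have hbe' : be' (r - 1) = 3/4 := by
    unfold be'; linear_combination 3/4 * hr2
  have hal' : al' (r - 1) = 3/4 := by
    unfold al'
    rw [div_eq_iff (by ring_nf; positivity)]
    ring_nf
    have h4 : r ^ 4 = 4 := by linear_combination (r ^ 2 + 2) * hr2
    rw [h4, hr2]
    ring
  have m0 := modular (p := r - 1) (by linarith) (by linarith)
  have m1 := modular_deriv (p := r - 1) (by linarith) (by linarith)
  rw [hal, hbe] at m0
  rw [hal, hbe, hal', hbe'] at m1
  have w := wronskian hx0 (by linarith)
  have s0 := F_sq hx0.le hx1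
  have s1 := F_sq_deriv hx0 hx1
  rw [hz] at s0 s1
  have hpi : √3 / (2 * π) = (√3 / π) / 2 := by field_simp
  have hpi2 : 3 * √3 / π = 3 * (√3 / π) := by ring
  rw [hpi] at w
  rw [hpi2]
  have hm1 : F1 (1 - x) = 4/3 * F0 x + r * F1 x := by linear_combination 4/3 * m1
  have hU : UU (1 - x) = 1/8 * F1 (1 - x) := by
    unfold UU; linear_combination (1/4 * F1 (1 - x)) * hz
  have hU2 : UU x = 1/8 * F1 x := by
    unfold UU; linear_combination (1/4 * F1 x) * hz
  rw [hU, hU2, hm1, m0] at w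
  have hlin : 1 - 2 * x = r / 2 := by rw [hx]; ring
  rw [hlin] at s1
  have s1' : ps (dd tt) (1/2) = r / 2 * (F0 x * F1 x) := by
    have : ps (dd tt) (1/2) * r = F0 x * F1 x := by linear_combination (-1/2) * s1
    linear_combination r / 2 * this - ps (dd tt) (1/2) / 2 * hr2
  rw [s1', ← s0]
  linear_combination 6 * w
end

section
/- The series ∑_{n=0}^∞ ((1/2)_n (1/4)_n (3/4)_n)/((1)_n^3) · (8n+1) · (1/9)^n equals 2√3/π. -/
open Real

open MeasureTheory Filter Topology

/-- falling factorial -/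
noncomputable def fallF (a : ℝ) (m : ℕ) : ℝ := ∏ i ∈ Finset.range m, (a - i)

lemma fallF_zero (a : ℝ) : fallF a 0 = 1 := by simp [fallF]

lemma fallF_succ (a : ℝ) (m : ℕ) : fallF a (m+1) = fallF a m * (a - m) := by
  simp [fallF, Finset.prod_range_succ]

lemma fallF_succ' (a : ℝ) (m : ℕ) : fallF (a+1) (m+1) = (a+1) * fallF a m := by
  simp only [fallF, Finset.prod_range_succ']
  rw [mul_comm]
  congr 1
  · simp
  · apply Finset.prod_congr rfl
    intro i _
    push_cast
    ring

lemma fallF_choose (a : ℝ) (m : ℕ) : Ring.choose a m = fallF a m / (m.factorial : ℝ) := by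
  have h := Ring.descPochhammer_eq_factorial_smul_choose a m
  rw [nsmul_eq_mul] at h
  have h2 : (descPochhammer ℤ m).smeval a = fallF a m := by
    rw [fallF, ← descPochhammer_eval_eq_prod_range m a, ← Polynomial.aeval_eq_smeval,
      Polynomial.aeval_def, ← Polynomial.eval_map, descPochhammer_map]
  rw [eq_div_iff (by positivity), mul_comm, ← h, h2]

lemma hasSum_binom (a u : ℝ) (hu : |u| < 1) :
    HasSum (fun m : ℕ => fallF a m / (m.factorial : ℝ) * u ^ m) ((1+u)^a) := by
  have h := (Real.one_add_rpow_hasFPowerSeriesOnBall_zero (a := a)).hasSum (y := u)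
    (by simpa [enorm_eq_nnnorm, ← NNReal.coe_lt_coe] using hu)
  rw [zero_add] at h
  have e : (fun m : ℕ => fallF a m / (m.factorial : ℝ) * u ^ m) =
      (fun n : ℕ => (binomialSeries ℝ a n) fun _ => u) := by
    funext m
    rw [binomialSeries_apply, fallF_choose]
    simp
  rw [e]
  exact h

lemma hasSum_binom_deriv (a u : ℝ) (hu : |u| < 1) :
    HasSum (fun m : ℕ => (m:ℝ) * (fallF a m / (m.factorial : ℝ) * u ^ m)) (a * u * (1+u)^(a-1)) := by
  rw [← hasSum_nat_add_iff' 1]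
  have h := (hasSum_binom (a-1) u hu).mul_left (a*u)
  have e : (fun m : ℕ => ((m+1:ℕ):ℝ) * (fallF a (m+1) / ((m+1).factorial : ℝ) * u ^ (m+1))) =
      (fun i : ℕ => a * u * (fallF (a-1) i / (i.factorial : ℝ) * u ^ i)) := by
    funext m
    have h1 := fallF_succ' (a-1) m
    rw [sub_add_cancel] at h1
    rw [h1, Nat.factorial_succ]
    have : (m.factorial : ℝ) ≠ 0 := by positivity
    push_cast
    field_simp
    ring
  rw [e]
  simpa using h

lemma cos_int_even (n : ℕ) : ∫ x in (0:ℝ)..π, cos x ^ (2*n) =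
    π * ((2*n).factorial : ℝ) / (4^n * (n.factorial:ℝ)^2) := by
  induction n with
  | zero => simp
  | succ n ih =>
    rw [mul_add, mul_one, integral_cos_pow, ih, Nat.factorial_succ (2*n+1), Nat.factorial_succ (2*n), Nat.factorial_succ n]
    simp only [sin_pi, sin_zero]
    push_cast
    have : (n.factorial : ℝ) ≠ 0 := by positivity
    field_simp
    ring

lemma cos_int_odd (n : ℕ) : ∫ x in (0:ℝ)..π, cos x ^ (2*n+1) = 0 := by
  induction n with
  | zero => simp
  | succ n ih =>
    rw [show 2*(n+1)+1 = (2*n+1)+2 by ring, integral_cos_pow, ih]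
    simp

noncomputable def sinI (m : ℕ) : ℝ := ∫ x in (0:ℝ)..π, sin x ^ m

lemma sinI_succ (m : ℕ) : sinI (m+2) = (m+1)/(m+2) * sinI m := by
  unfold sinI
  rw [integral_sin_pow]; simp

lemma sinI_pos (m : ℕ) : 0 < sinI m := integral_sin_pow_pos m

noncomputable def T (κ n : ℕ) : ℝ :=
  (√3/2)^κ * fallF ((κ+1)/2) (2*n) * sinI (κ+2*n) / ((n.factorial:ℝ)^2 * 36^n)

noncomputable def F (κ n : ℕ) : ℝ :=
  (√3/2)^κ * fallF ((κ-1)/2) (2*n) * sinI (κ+2*n) / ((n.factorial:ℝ)^2 * 36^n) * (8*n+1+κ)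

lemma T_succ (κ n : ℕ) : T κ (n+1) = T κ n * ((((κ:ℝ)+1)/2 - 2*n) * (((κ:ℝ)+1)/2 - 2*n-1) / (36*(n+1)^2)
    * ((κ+2*n+1)/(κ+2*n+2))) := by
  unfold T
  rw [mul_add, mul_one, fallF_succ, fallF_succ, ← add_assoc, sinI_succ, Nat.factorial_succ]
  have : (n.factorial : ℝ) ≠ 0 := by positivity
  push_cast
  field_simp
  ring

lemma F_eq1 (κ n : ℕ) : F κ n = T κ n * (((κ:ℝ)+1)/2 - 2*n) * (8*n+1+κ) / (((κ:ℝ)+1)/2) := by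
  have h : fallF (((κ:ℝ)-1)/2) (2*n) = fallF ((κ+1)/2) (2*n) * (((κ:ℝ)+1)/2 - 2*n) / (((κ:ℝ)+1)/2) := by
    rw [eq_div_iff (by positivity)]
    have h1 := fallF_succ' (((κ:ℝ)-1)/2) (2*n)
    have h2 := fallF_succ (((κ:ℝ)+1)/2) (2*n)
    rw [show ((κ:ℝ)-1)/2+1 = ((κ:ℝ)+1)/2 by ring] at h1
    push_cast at h2
    linarith
  unfold F T
  rw [h]
  ring

lemma F_eq2 (κ n : ℕ) : F (κ+2) n = T κ n * (3/4) * (8*n+3+κ) * ((κ+2*n+1)/(κ+2*n+2)) := by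
  unfold F T
  rw [show κ+2+2*n = (κ+2*n)+2 by ring, sinI_succ, pow_add, div_pow (√3) 2 2, sq_sqrt (by norm_num)]
  push_cast
  rw [show ((κ:ℝ)+2-1)/2 = (κ+1)/2 by ring]
  ring

lemma WZ (κ n : ℕ) : F (κ+2) n - F κ n =
   (-36/(κ+1)) * ((n+1:ℕ):ℝ)^2 * T κ (n+1) - (-36/(κ+1)) * (n:ℝ)^2 * T κ n := by
  rw [F_eq1 κ n, F_eq2, T_succ]
  push_cast
  field_simp
  ring

lemma summable_nT (κ : ℕ) : Summable (fun n : ℕ => (n:ℝ)^2 * T κ n) := by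
  apply summable_of_ratio_norm_eventually_le (r := 1/2) (by norm_num)
  filter_upwards [eventually_ge_atTop (κ+1)] with n hn
  have hn' : (κ:ℝ)+1 ≤ n := by exact_mod_cast hn
  have hk : (0:ℝ) ≤ κ := by positivity
  rw [T_succ]
  simp only [norm_mul, norm_pow, norm_div, Real.norm_eq_abs]
  push_cast
  have e1 : |((κ:ℝ)+1)/2 - 2*n| ≤ 3*n := by rw [abs_le]; constructor <;> linarith
  have e2 : |((κ:ℝ)+1)/2 - 2*n-1| ≤ 3*n := by rw [abs_le]; constructor <;> linarith
  rw [abs_of_pos (show (0:ℝ) < n+1 by positivity), abs_of_pos (show (0:ℝ) < 36 by positivity),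
    abs_of_pos (show (0:ℝ) < κ+2*n+1 by positivity), abs_of_pos (show (0:ℝ) < κ+2*n+2 by positivity),
    abs_of_nonneg (show (0:ℝ) ≤ n by positivity)]
  have e3 : ((κ:ℝ)+2*n+1)/(κ+2*n+2) ≤ 1 := by rw [div_le_one (by positivity)]; linarith
  have e4 : |((κ:ℝ)+1)/2 - 2*n| * |((κ:ℝ)+1)/2 - 2*n-1| ≤ (3*n)*(3*n) := by gcongr
  have hT := abs_nonneg (T κ n)
  calc _ = |T κ n| * (|((κ:ℝ)+1)/2 - 2*n| * |((κ:ℝ)+1)/2 - 2*n-1|) / 36 * (((κ:ℝ)+2*n+1)/(κ+2*n+2)) := by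
        field_simp
    _ ≤ |T κ n| * ((3*n)*(3*n)) / 36 * 1 := by gcongr
    _ ≤ _ := by nlinarith [mul_nonneg hT (sq_nonneg (n:ℝ))]

lemma sum_shift (κ : ℕ) (I J : ℝ) (hI : HasSum (F κ) I) (hJ : HasSum (F (κ+2)) J) : J = I := by
  have h1 := (hJ.sub hI).tendsto_sum_nat
  have h2 : ∀ N, ∑ n ∈ Finset.range N, (F (κ+2) n - F κ n) = (-36/(κ+1)) * ((N:ℝ)^2 * T κ N) := by
    intro N
    rw [Finset.sum_congr rfl (fun n _ => WZ κ n), Finset.sum_range_sub (fun n : ℕ => (-36/((κ:ℝ)+1)) * (n:ℝ)^2 * T κ n)]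
    simp; ring
  simp only [h2] at h1
  have h3 := ((summable_nT κ).tendsto_atTop_zero).const_mul (-36/((κ:ℝ)+1))
  have := tendsto_nhds_unique h1 h3
  linarith

noncomputable def muI : Measure ℝ := volume.restrict (Set.Ioc 0 π)

instance : IsFiniteMeasure muI := by unfold muI; infer_instance

noncomputable def mu2 : Measure (ℝ × ℝ) := muI.prod muI

instance : IsFiniteMeasure mu2 := by unfold mu2; infer_instance

noncomputable def uu (p : ℝ × ℝ) : ℝ := sin p.1 * cos p.2 / 3
noncomputable def vv (p : ℝ × ℝ) : ℝ := √3/2 * sin p.1 * √(1 + uu p)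
noncomputable def AA (p : ℝ × ℝ) : ℝ := (√(1 + uu p))⁻¹ * (1 + 2 * uu p / (1 + uu p))
noncomputable def BB (p : ℝ × ℝ) : ℝ := (√(1 + uu p))⁻¹ * (1 - 2 * uu p / (1 + uu p))
noncomputable def HH (κ : ℕ) (p : ℝ × ℝ) : ℝ := vv p ^ κ * (κ * AA p + BB p)

lemma abs_uu (p : ℝ × ℝ) : |uu p| ≤ 1/3 := by
  unfold uu
  rw [abs_div, abs_mul]
  have h1 := abs_sin_le_one p.1
  have h2 := abs_cos_le_one p.2
  have : |sin p.1| * |cos p.2| ≤ 1 := mul_le_one₀ h1 (abs_nonneg _) h2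
  rw [abs_of_pos (by norm_num : (0:ℝ) < 3)]
  linarith

lemma one_add_uu_pos (p : ℝ × ℝ) : 0 < 1 + uu p := by
  have := abs_le.1 (abs_uu p); linarith [this.1]

lemma cont_uu : Continuous uu := by unfold uu; fun_prop
lemma cont_vv : Continuous vv := by
  have := cont_uu
  unfold vv; fun_prop
lemma cont_AA : Continuous AA := by
  have := cont_uu
  have h : ∀ p, √(1 + uu p) ≠ 0 := fun p => (sqrt_pos.2 (one_add_uu_pos p)).ne'
  have h' : ∀ p, (1 + uu p) ≠ 0 := fun p => ((one_add_uu_pos p)).ne'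
  unfold AA; fun_prop (disch := assumption)
lemma cont_BB : Continuous BB := by
  have := cont_uu
  have h : ∀ p, √(1 + uu p) ≠ 0 := fun p => (sqrt_pos.2 (one_add_uu_pos p)).ne'
  have h' : ∀ p, (1 + uu p) ≠ 0 := fun p => ((one_add_uu_pos p)).ne'
  unfold BB; fun_prop (disch := assumption)

lemma AB_bound (p : ℝ × ℝ) : |AA p| ≤ 4 ∧ |BB p| ≤ 4 := by
  have h0 := one_add_uu_pos p
  have hu := abs_le.1 (abs_uu p)
  have hs : (√(1 + uu p))⁻¹ ≤ 2 := by
    rw [inv_le_comm₀ (sqrt_pos.2 h0) (by norm_num)]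
    apply le_sqrt_of_sq_le
    linarith [hu.1]
  have hs0 : 0 ≤ (√(1 + uu p))⁻¹ := by positivity
  have hq : |2 * uu p / (1 + uu p)| ≤ 1 := by
    rw [abs_div, abs_of_pos h0, div_le_one h0, abs_le]
    constructor <;> linarith [hu.1, hu.2]
  have hq' := abs_le.1 hq
  unfold AA BB
  rw [abs_mul, abs_mul, abs_of_nonneg hs0, abs_of_nonneg (by linarith [hq'.1]), abs_of_nonneg (by linarith [hq'.2])]
  constructor <;> nlinarith [hq'.1, hq'.2]

/-- terms of the double-integral expansion -/
noncomputable def gg (κ m : ℕ) (p : ℝ × ℝ) : ℝ :=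
  (√3/2)^κ * (fallF ((κ-1)/2) m / (m.factorial:ℝ) * (4*m+1+κ) * (1/3)^m) *
    (sin p.1 ^ (κ+m) * cos p.2 ^ m)

lemma hasSum_gg (κ : ℕ) (p : ℝ × ℝ) : HasSum (fun m => gg κ m p) (HH κ p) := by
  have hu : |uu p| < 1 := lt_of_le_of_lt (abs_uu p) (by norm_num)
  have h0 := one_add_uu_pos p
  have h1 := ((hasSum_binom (((κ:ℝ)-1)/2) (uu p) hu).mul_left (1+(κ:ℝ))).add
    ((hasSum_binom_deriv (((κ:ℝ)-1)/2) (uu p) hu).mul_left 4)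
  have h2 := h1.mul_left ((√3/2)^κ * sin p.1 ^ κ)
  have e : (1 + uu p) ^ (((κ:ℝ)-1)/2) = √(1 + uu p) ^ κ * (√(1 + uu p))⁻¹ := by
    rw [sqrt_eq_rpow, ← rpow_natCast, ← rpow_mul h0.le, ← rpow_neg h0.le, ← rpow_add h0]
    congr 1; ring
  have e1 : (fun m => gg κ m p) = fun i : ℕ => (√3 / 2) ^ κ * sin p.1 ^ κ *
      ((1 + (κ:ℝ)) * (fallF (((κ:ℝ) - 1) / 2) i / (i.factorial:ℝ) * uu p ^ i) +
        4 * ((i:ℝ) * (fallF (((κ:ℝ) - 1) / 2) i / (i.factorial:ℝ) * uu p ^ i))) := by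
    funext m
    unfold gg uu
    rw [pow_add, div_pow (sin p.1 * cos p.2), mul_pow (sin p.1), one_div, inv_pow]
    ring
  have e2 : HH κ p = (√3 / 2) ^ κ * sin p.1 ^ κ *
      ((1 + (κ:ℝ)) * (1 + uu p) ^ (((κ:ℝ) - 1) / 2) +
        4 * (((κ:ℝ) - 1) / 2 * uu p * (1 + uu p) ^ (((κ:ℝ) - 1) / 2 - 1))) := by
    rw [rpow_sub h0, rpow_one, e]
    unfold HH AA BB vv
    rw [mul_pow, mul_pow]
    ring
  rw [e1, e2]
  exact h2

lemma summable_coef (κ : ℕ) :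
    Summable (fun m : ℕ => fallF (((κ:ℝ)-1)/2) m / (m.factorial:ℝ) * (4*m+1+κ) * (1/3)^m) := by
  apply summable_of_ratio_norm_eventually_le (r := 9/10) (by norm_num)
  filter_upwards [eventually_ge_atTop (κ+1)] with n hn
  have hn' : (κ:ℝ)+1 ≤ n := by exact_mod_cast hn
  have hk : (0:ℝ) ≤ κ := by positivity
  rw [fallF_succ, Nat.factorial_succ, pow_succ]
  push_cast
  simp only [norm_mul, norm_pow, norm_div, Real.norm_eq_abs, Nat.abs_cast]
  have e1 : |((κ:ℝ)-1)/2 - n| ≤ n+1 := by rw [abs_le]; constructor <;> linarith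
  have hf : (n.factorial : ℝ) ≠ 0 := by positivity
  rw [abs_of_pos (show (0:ℝ) < n+1 by positivity),
    abs_of_pos (show (0:ℝ) < 4*(n+1)+1+κ by positivity), abs_of_pos (show (0:ℝ) < 4*n+1+κ by positivity)]
  simp only [abs_one, abs_of_pos (show (0:ℝ) < 3 by norm_num)]
  set f := |fallF (((κ:ℝ)-1)/2) n|
  have hf0 : 0 ≤ f := abs_nonneg _
  calc _ = f / n.factorial * (1/3)^n * (|((κ:ℝ)-1)/2 - n| / (n+1)) * ((4*(n+1)+1+κ) * (1/3)) := by
        field_simp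
    _ ≤ f / n.factorial * (1/3)^n * 1 * ((9/10) * (4*n+1+κ)) := by
        have e2 : |((κ:ℝ)-1)/2 - n| / (n+1) ≤ 1 := by
          rw [div_le_one (by positivity)]; exact e1
        have e3 : ((4:ℝ)*(n+1)+1+κ) * (1/3) ≤ (9/10) * (4*n+1+κ) := by linarith
        exact mul_le_mul (mul_le_mul_of_nonneg_left e2 (by positivity)) e3 (by positivity) (by positivity)
    _ = _ := by ring

lemma cont_gg (κ m : ℕ) : Continuous (gg κ m) := by unfold gg; fun_prop

lemma gg_bound (κ m : ℕ) (p : ℝ × ℝ) : ‖gg κ m p‖ ≤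
    (√3/2)^κ * ‖fallF (((κ:ℝ)-1)/2) m / (m.factorial:ℝ) * (4*m+1+κ) * (1/3)^m‖ := by
  unfold gg
  rw [norm_mul, norm_mul, norm_of_nonneg (show 0 ≤ (√3/2)^κ by positivity)]
  have : ‖sin p.1 ^ (κ+m) * cos p.2 ^ m‖ ≤ 1 := by
    rw [norm_mul, norm_pow, norm_pow]
    exact mul_le_one₀ (pow_le_one₀ (norm_nonneg _) (abs_sin_le_one _)) (by positivity)
      (pow_le_one₀ (norm_nonneg _) (abs_cos_le_one _))
  exact mul_le_of_le_one_right (by positivity) this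

lemma hasSum_int (κ : ℕ) : HasSum (fun m => ∫ p, gg κ m p ∂mu2) (∫ p, HH κ p ∂mu2) := by
  apply hasSum_integral_of_dominated_convergence
    (fun m _ => (√3/2)^κ * ‖fallF (((κ:ℝ)-1)/2) m / (m.factorial:ℝ) * (4*m+1+κ) * (1/3)^m‖)
  · intro m; exact (cont_gg κ m).aestronglyMeasurable
  · intro m; exact Eventually.of_forall (fun p => gg_bound κ m p)
  · exact Eventually.of_forall (fun p => ((summable_coef κ).norm.mul_left _))
  · exact integrable_const _
  · exact Eventually.of_forall (fun p => hasSum_gg κ p)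

lemma int_gg (κ m : ℕ) : ∫ p, gg κ m p ∂mu2 =
  (√3/2)^κ * (fallF ((κ-1)/2) m / (m.factorial:ℝ) * (4*m+1+κ) * (1/3)^m) *
    (sinI (κ+m) * ∫ x in (0:ℝ)..π, cos x ^ m) := by
  unfold gg mu2 sinI
  rw [integral_const_mul, integral_prod_mul (fun x => sin x ^ (κ+m)) (fun x => cos x ^ m),
    intervalIntegral.integral_of_le pi_pos.le, intervalIntegral.integral_of_le pi_pos.le]
  rfl

lemma hasSum_F (κ : ℕ) : HasSum (fun n => π * F κ n) (∫ p, HH κ p ∂mu2) := by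
  have h := hasSum_int κ
  have hinj : Function.Injective (fun n : ℕ => 2*n) := fun a b h => by simpa using h
  rw [← hinj.hasSum_iff] at h
  · convert h using 1
    funext n
    simp only [Function.comp]
    rw [int_gg, cos_int_even]
    have h1 : (n.factorial : ℝ) ≠ 0 := by positivity
    have h2 : ((2*n).factorial : ℝ) ≠ 0 := by positivity
    have e36 : (36:ℝ)^n = 4^n * 9^n := by rw [← mul_pow]; norm_num
    have e9 : (1/3:ℝ)^(2*n) = 1/9^n := by rw [pow_mul, div_pow, one_pow, div_pow, one_pow]; norm_num
    unfold F
    rw [e36, e9]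
    push_cast
    field_simp
    ring
  · intro m hm
    rcases Nat.even_or_odd' m with ⟨k, rfl | rfl⟩
    · exact absurd ⟨k, rfl⟩ hm
    · rw [int_gg, cos_int_odd]; simp

lemma lim_HH : Tendsto (fun κ => ∫ p, (HH (κ+1) p - HH κ p) ∂mu2) atTop (𝓝 0) := by
  have hmem : ∀ᵐ p ∂mu2, p.1 ∈ Set.Ioc 0 π ∧ p.2 ∈ Set.Ioc 0 π := by
    have : mu2 = volume.restrict (Set.Ioc 0 π ×ˢ Set.Ioc 0 π) := by
      unfold mu2 muI
      rw [Measure.prod_restrict]; rfl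
    rw [this]
    filter_upwards [ae_restrict_mem (measurableSet_Ioc.prod measurableSet_Ioc)] with p hp using hp
  have hv : ∀ p : ℝ × ℝ, p.1 ∈ Set.Ioc 0 π ∧ p.2 ∈ Set.Ioc 0 π → 0 ≤ vv p ∧ vv p < 1 := by
    rintro p ⟨h1, h2⟩
    have hs : 0 ≤ sin p.1 := sin_nonneg_of_nonneg_of_le_pi h1.1.le h1.2
    have hs1 := sin_le_one p.1
    have hc : cos p.2 < 1 := by
      rw [← cos_zero]
      exact cos_lt_cos_of_nonneg_of_le_pi le_rfl h2.2 h2.1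
    have h0 := one_add_uu_pos p
    have hv0 : 0 ≤ vv p := by unfold vv; positivity
    refine ⟨hv0, ?_⟩
    have hsq : vv p ^ 2 = 3/4 * sin p.1 ^2 * (1 + uu p) := by
      unfold vv
      rw [mul_pow, mul_pow, div_pow, sq_sqrt (by norm_num), sq_sqrt h0.le]; norm_num
    have hu : sin p.1 ^ 2 * (1 + uu p) < 4/3 := by
      rcases hs.eq_or_lt with h | h
      · rw [← h]; norm_num
      · have : uu p < 1/3 := by
          unfold uu
          have : sin p.1 * cos p.2 < sin p.1 * 1 := mul_lt_mul_of_pos_left hc h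
          linarith
        have h3 : sin p.1 ^ 2 ≤ 1 := pow_le_one₀ hs hs1
        nlinarith
    have : vv p ^ 2 < 1 := by rw [hsq]; linarith
    nlinarith
  have key : ∀ (κ : ℕ) p, HH (κ+1) p - HH κ p =
      (κ * vv p ^ κ) * (vv p - 1) * AA p + vv p ^ κ * ((vv p - 1) * BB p + vv p * AA p) := by
    intro κ p; unfold HH; push_cast; ring
  have hz : (0:ℝ) = ∫ p, (0:ℝ) ∂mu2 := by simp
  rw [hz]
  apply tendsto_integral_of_dominated_convergence (fun _ => (12:ℝ))
  · intro κ
    have := cont_AA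
    have := cont_BB
    have := cont_vv
    apply Continuous.aestronglyMeasurable
    unfold HH; fun_prop
  · exact integrable_const _
  · intro κ
    filter_upwards [hmem] with p hp
    obtain ⟨h0, h1⟩ := hv p hp
    obtain ⟨ha, hb⟩ := AB_bound p
    rw [key]
    have hk : (κ * vv p ^ κ) * (1 - vv p) ≤ 1 := by
      have hg := geom_sum_mul_neg (vv p) κ
      have : κ * vv p ^ κ ≤ ∑ i ∈ Finset.range κ, vv p ^ i := by
        rw [← nsmul_eq_mul]
        have := Finset.card_nsmul_le_sum (Finset.range κ) (fun i => vv p ^ i) (vv p ^ κ)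
          (fun i hi => pow_le_pow_of_le_one h0 h1.le (Finset.mem_range.1 hi).le)
        simpa using this
      have h2 := mul_le_mul_of_nonneg_right this (sub_nonneg.2 h1.le)
      have h3 : 0 ≤ vv p ^ κ := by positivity
      linarith
    have hk0 : 0 ≤ (κ * vv p ^ κ) * (1 - vv p) := mul_nonneg (by positivity) (by linarith)
    have hp1 : vv p ^ κ ≤ 1 := pow_le_one₀ h0 h1.le
    have hp0 : 0 ≤ vv p ^ κ := by positivity
    have t1 : ‖(κ * vv p ^ κ) * (vv p - 1) * AA p‖ ≤ 4 := by
      rw [norm_mul, show (κ * vv p ^ κ) * (vv p - 1) = -((κ * vv p ^ κ) * (1 - vv p)) by ring, norm_neg,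
        norm_of_nonneg hk0, Real.norm_eq_abs]
      nlinarith [abs_nonneg (AA p)]
    have t2 : ‖vv p ^ κ * ((vv p - 1) * BB p + vv p * AA p)‖ ≤ 8 := by
      rw [norm_mul, norm_of_nonneg hp0]
      have : ‖(vv p - 1) * BB p + vv p * AA p‖ ≤ 8 := by
        refine (norm_add_le _ _).trans ?_
        rw [norm_mul, norm_mul, norm_of_nonneg h0, Real.norm_eq_abs, Real.norm_eq_abs, Real.norm_eq_abs,
          abs_of_nonpos (by linarith : vv p - 1 ≤ 0)]
        nlinarith [abs_nonneg (AA p), abs_nonneg (BB p)]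
      nlinarith [norm_nonneg ((vv p - 1) * BB p + vv p * AA p)]
    refine (norm_add_le _ _).trans ?_
    linarith
  · filter_upwards [hmem] with p hp
    obtain ⟨h0, h1⟩ := hv p hp
    simp only [key]
    have l1 := tendsto_self_mul_const_pow_of_lt_one h0 h1
    have l2 := tendsto_pow_atTop_nhds_zero_of_lt_one h0 h1
    have := ((l1.mul_const (vv p - 1)).mul_const (AA p)).add (l2.mul_const ((vv p - 1) * BB p + vv p * AA p))
    simpa using this

lemma int_HH (κ : ℕ) : Integrable (HH κ) mu2 := by
  have h1 := cont_AA
  have h2 := cont_BB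
  have h3 := cont_vv
  have hc : Continuous (HH κ) := by unfold HH; fun_prop
  have : mu2 = volume.restrict (Set.Ioc 0 π ×ˢ Set.Ioc 0 π) := by
    unfold mu2 muI
    rw [Measure.prod_restrict]; rfl
  rw [this]
  have hi : IntegrableOn (HH κ) (Set.Icc 0 π ×ˢ Set.Icc 0 π) volume :=
    hc.continuousOn.integrableOn_compact (isCompact_Icc.prod isCompact_Icc)
  exact hi.mono_set (Set.prod_mono Set.Ioc_subset_Icc_self Set.Ioc_subset_Icc_self)

lemma I_shift (κ : ℕ) : ∫ p, HH (κ+2) p ∂mu2 = ∫ p, HH κ p ∂mu2 := by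
  have h (κ : ℕ) : HasSum (F κ) ((∫ p, HH κ p ∂mu2)/π) := by
    have := (hasSum_F κ).div_const π
    simpa [mul_div_cancel_left₀, pi_ne_zero] using this
  have := sum_shift κ _ _ (h κ) (h (κ+2))
  field_simp at this
  exact this

lemma I_eq : ∫ p, HH 1 p ∂mu2 = ∫ p, HH 0 p ∂mu2 := by
  have h0 : ∀ j : ℕ, ∫ p, HH (2*j) p ∂mu2 = ∫ p, HH 0 p ∂mu2 := by
    intro j
    induction j with
    | zero => rfl
    | succ j ih => rw [mul_add, mul_one, I_shift, ih]
  have h1 : ∀ j : ℕ, ∫ p, HH (2*j+1) p ∂mu2 = ∫ p, HH 1 p ∂mu2 := by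
    intro j
    induction j with
    | zero => rfl
    | succ j ih => rw [show 2*(j+1)+1 = (2*j+1)+2 by ring, I_shift, ih]
  have hl := lim_HH.comp (tendsto_id.const_mul_atTop' (show 0 < 2 by norm_num) : Tendsto (fun j : ℕ => 2 * j) atTop atTop)
  have e : ((fun κ => ∫ p, (HH (κ+1) p - HH κ p) ∂mu2) ∘ fun j : ℕ => 2 * j) =
      fun _ => ∫ p, HH 1 p ∂mu2 - ∫ p, HH 0 p ∂mu2 := by
    funext j
    simp only [Function.comp]
    rw [integral_sub (int_HH _) (int_HH _), h0, h1]
  rw [e] at hl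
  have := tendsto_nhds_unique hl tendsto_const_nhds
  linarith

lemma I_one : ∫ p, HH 1 p ∂mu2 = π * (2 * √3) := by
  have h := hasSum_F 1
  have h2 : HasSum (fun n => π * F 1 n) (π * F 1 0) := by
    apply hasSum_single
    intro n hn
    obtain ⟨m, rfl⟩ := Nat.exists_eq_succ_of_ne_zero hn
    have : fallF ((((1:ℕ):ℝ)-1)/2) (2*(m+1)) = 0 := by
      unfold fallF
      apply Finset.prod_eq_zero (i := 0) (by simp)
      simp
    unfold F
    rw [Nat.succ_eq_add_one, this]; simp
  rw [h.unique h2]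
  simp [F, fallF_zero, sinI]
  ring

lemma F_zero (n : ℕ) : F 0 n = π * ((poch (1/2) n * poch (1/4) n * poch (3/4) n) / (poch 1 n)^3 * (8*(n:ℝ)+1) * ((1:ℝ)/9)^n) := by
  have hp : ∀ (a : ℝ) (n : ℕ), poch a (n+1) = poch a n * (a + n) := by
    intro a n; unfold poch; rw [ascPochhammer_succ_eval]
  have hp0 : ∀ a : ℝ, poch a 0 = 1 := by intro a; simp [poch]
  have h1 : ∀ n : ℕ, poch 1 n = n.factorial := by
    intro n
    induction n with
    | zero => simp [hp0]
    | succ n ih => rw [hp, ih, Nat.factorial_succ]; push_cast; ring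
  have h2 : ∀ n : ℕ, fallF (-1/2) (2*n) = 4^n * (poch (1/4) n * poch (3/4) n) := by
    intro n
    induction n with
    | zero => simp [hp0, fallF_zero]
    | succ n ih =>
      rw [mul_add, mul_one, fallF_succ, fallF_succ, ih, hp, hp]; push_cast; ring
  have h3 : ∀ n : ℕ, sinI (2*n) = π * poch (1/2) n / n.factorial := by
    intro n
    induction n with
    | zero => simp [hp0, sinI]
    | succ n ih =>
      rw [mul_add, mul_one, sinI_succ, ih, hp, Nat.factorial_succ]; push_cast
      have : (n.factorial : ℝ) ≠ 0 := by positivity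
      field_simp
      ring
  unfold F
  rw [zero_add, h3, h1]
  simp only [Nat.cast_zero, zero_sub, h2]
  have : (n.factorial : ℝ) ≠ 0 := by positivity
  have e36 : (36:ℝ)^n = 4^n * 9^n := by rw [← mul_pow]; norm_num
  rw [e36, one_div_pow]
  field_simp
  ring

theorem stmt_1 :
    ∑' n : ℕ, (poch (1/2) n * poch (1/4) n * poch (3/4) n) / (poch 1 n)^3 * (8*(n:ℝ)+1) * ((1:ℝ)/9)^n = 2 * Real.sqrt 3 / π := by
  have h := hasSum_F 0
  rw [← I_eq, I_one] at h
  simp only [F_zero] at h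
  have h2 := h.div_const (π * π)
  have hpi := pi_ne_zero
  rw [show π * (2 * √3) / (π * π) = 2 * √3 / π by field_simp] at h2
  rw [← h2.tsum_eq]
  apply tsum_congr
  intro n
  field_simp
end
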